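/- Let θ1, θ2, θ3, θ4 > 0 with θ1 + θ2 + θ3 + θ4 = π and set a_i = cot θ_i. The sum of the three nonzero eigenvalues of L₄ satisfies λ1 + λ2 + λ3 = 2(a1 + a2 + a3 + a4) ≥ 8, with equality if and only if θ1 = θ2 = θ3 = θ4 = π/4. (Among all cyclic quadrilaterals, a square has the minimal λ1 + λ2 + λ3.) -/

import Mathlib

open Real

/-- Halving the sum of two angles: the defect in the midpoint inequality for the cotangent. -/
lemma cot_add_cot_sub_two_mul_cot_half {a b : ℝ} (ha : sin a ≠ 0) (hb : sin b ≠ 0)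
    (hab : sin ((a + b) / 2) ≠ 0) :
    cot a + cot b - 2 * cot ((a + b) / 2) =
      2 * cos ((a + b) / 2) * sin ((a - b) / 2) ^ 2 /
        (sin ((a + b) / 2) * (sin a * sin b)) := by
  obtain ⟨s, d, rfl, rfl⟩ : ∃ s d, a = s + d ∧ b = s - d :=
    ⟨(a + b) / 2, (a - b) / 2, by ring, by ring⟩
  have hs : (s + d + (s - d)) / 2 = s := by ring
  have hd : (s + d - (s - d)) / 2 = d := by ring
  rw [hs] at hab
  rw [hs, hd, cot_eq_cos_div_sin, cot_eq_cos_div_sin, cot_eq_cos_div_sin]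
  field_simp
  rw [sin_add, sin_sub, cos_add, cos_sub]
  linear_combination 2 * cos s * sin d ^ 2 * sin_sq_add_cos_sq s

lemma two_mul_cot_half_le {a b : ℝ} (ha : 0 < a) (hb : 0 < b) (hab : a + b < π) :
    2 * cot ((a + b) / 2) ≤ cot a + cot b ∧
      (cot a + cot b = 2 * cot ((a + b) / 2) → a = b) := by
  have hsa : 0 < sin a := sin_pos_of_pos_of_lt_pi ha (by linarith)
  have hsb : 0 < sin b := sin_pos_of_pos_of_lt_pi hb (by linarith)
  have hss : 0 < sin ((a + b) / 2) := sin_pos_of_pos_of_lt_pi (by linarith) (by linarith)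
  have hcs : 0 < cos ((a + b) / 2) := cos_pos_of_mem_Ioo ⟨by linarith, by linarith⟩
  have key := cot_add_cot_sub_two_mul_cot_half hsa.ne' hsb.ne' hss.ne'
  refine ⟨sub_nonneg.1 (key ▸ by positivity), fun h => ?_⟩
  rw [sub_eq_zero.2 h, eq_comm, div_eq_zero_iff] at key
  have hd : sin ((a - b) / 2) = 0 := by
    simpa [hcs.ne', hss.ne', hsa.ne', hsb.ne'] using key
  have := (sin_eq_zero_iff_of_lt_of_lt (by linarith) (by linarith)).1 hd
  linarith

lemma cot_pi_div_four : cot (π / 4) = 1 := by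
  rw [← tan_inv_eq_cot, tan_pi_div_four, inv_one]

lemma four_le_sum_cot {a b c d : ℝ} (ha : 0 < a) (hb : 0 < b) (hc : 0 < c) (hd : 0 < d)
    (hsum : a + b + c + d = π) :
    4 ≤ cot a + cot b + cot c + cot d ∧
      (cot a + cot b + cot c + cot d = 4 ↔ a = π / 4 ∧ b = π / 4 ∧ c = π / 4 ∧ d = π / 4) := by
  obtain ⟨hab, hab'⟩ := two_mul_cot_half_le ha hb (by linarith)
  obtain ⟨hcd, hcd'⟩ := two_mul_cot_half_le hc hd (by linarith)
  obtain ⟨hm, hm'⟩ := two_mul_cot_half_le (a := (a + b) / 2) (b := (c + d) / 2)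
    (by linarith) (by linarith) (by linarith)
  have hq : ((a + b) / 2 + (c + d) / 2) / 2 = π / 4 := by linarith
  rw [hq, cot_pi_div_four] at hm hm'
  refine ⟨by linarith, fun h => ?_, ?_⟩
  · have h₁ := hab' (by linarith)
    have h₂ := hcd' (by linarith)
    have h₃ := hm' (by linarith)
    refine ⟨?_, ?_, ?_, ?_⟩ <;> linarith
  · rintro ⟨rfl, rfl, rfl, rfl⟩
    rw [cot_pi_div_four]
    norm_num

theorem sum_lambda_L4 (θ1 θ2 θ3 θ4 : ℝ)
    (h1 : 0 < θ1) (h2 : 0 < θ2) (h3 : 0 < θ3) (h4 : 0 < θ4)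
    (hsum : θ1 + θ2 + θ3 + θ4 = Real.pi)
    (a1 a2 a3 a4 : ℝ) (ha1 : a1 = Real.cot θ1) (ha2 : a2 = Real.cot θ2)
    (ha3 : a3 = Real.cot θ3) (ha4 : a4 = Real.cot θ4)
    (L : Matrix (Fin 4) (Fin 4) ℝ)
    (hL : L = !![a1 + a4, -a1, 0, -a4;
                 -a1, a1 + a2, -a2, 0;
                 0, -a2, a2 + a3, -a3;
                 -a4, 0, -a3, a3 + a4])
    (l1 l2 l3 : ℝ) (hl1 : 0 ≤ l1) (hl12 : l1 ≤ l2) (hl23 : l2 ≤ l3)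
    (hchar : ∀ x : ℝ, (x • (1 : Matrix (Fin 4) (Fin 4) ℝ) - L).det
      = x * (x - l1) * (x - l2) * (x - l3)) :
    l1 + l2 + l3 = 2 * (a1 + a2 + a3 + a4) ∧
    8 ≤ l1 + l2 + l3 ∧
    (l1 + l2 + l3 = 8 ↔ θ1 = Real.pi / 4 ∧ θ2 = Real.pi / 4 ∧ θ3 = Real.pi / 4 ∧ θ4 = Real.pi / 4) := by
  have htrace : l1 + l2 + l3 = 2 * (a1 + a2 + a3 + a4) := by
    have e1 := hchar 1
    have e2 := hchar (-1)
    have e3 := hchar 2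
    have e4 := hchar (-2)
    simp [hL, Matrix.det_succ_row_zero, Fin.sum_univ_succ, Fin.succAbove, Matrix.one_apply]
      at e1 e2 e3 e4
    linarith
  obtain ⟨hle, hiff⟩ := four_le_sum_cot h1 h2 h3 h4 hsum
  rw [← ha1, ← ha2, ← ha3, ← ha4] at hle hiff
  refine ⟨htrace, by linarith, ?_⟩
  rw [← hiff, htrace]
  constructor <;> intro h <;> linarith
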